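/- arXiv:1504.00168 — 2 statements merged into one kernel-verified Lean document; each statement's English description precedes it below -/
import Mathlib

section
/- Let $(M_i)_{i\in I}$ be a family of $R$-modules, $M = \bigoplus_{i\in I} M_i$, $P = \prod_{i\in I} M_i$, $A = \bigcap_{n\ge 1}(M + \mathfrak m^n P)$, and assume $M/H(M)$ is a flat $R$-module, where $H(M) = \bigcap_{n\ge 1}\mathfrak m^n M$. Then $P/A$ is a flat $R$-module. -/
/- Throughout, `(R, 𝔪)` is a commutative noetherian local ring and all modules are `R`-modules.
`AdicCompletion (maximalIdeal R) M` is the `𝔪`-adic completion `lim M/𝔪^n M` and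
`IsHausdorff (maximalIdeal R) M` says that `M` is (`𝔪`-adically) separated. -/

open TensorProduct IsLocalRing

universe u

section Definitions

variable (R : Type u) [CommRing R]

/-- A linear map is a *pure monomorphism* if it is injective and remains injective after
tensoring with an arbitrary module. -/
def IsPureMono {M N : Type u} [AddCommGroup M] [Module R M] [AddCommGroup N] [Module R N]
    (f : M →ₗ[R] N) : Prop :=
  Function.Injective f ∧
    ∀ (X : Type u) [AddCommGroup X] [Module R X], Function.Injective (LinearMap.lTensor X f)

/-- A module `N` is *pure-injective* if every pure monomorphism out of `N` splits. -/
def IsPureInjective (N : Type u) [AddCommGroup N] [Module R N] : Prop :=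
  ∀ (Y : Type u) [AddCommGroup Y] [Module R Y] (f : N →ₗ[R] Y),
    IsPureMono R f → ∃ g : Y →ₗ[R] N, g ∘ₗ f = LinearMap.id

/-- A submodule `A ⊆ B` is *pure* if its inclusion is a pure monomorphism. -/
def IsPureSubmodule {B : Type u} [AddCommGroup B] [Module R B] (A : Submodule R B) : Prop :=
  IsPureMono R A.subtype

/-- An extension `A ⊆ B` is *pure-essential* if `A` is pure in `B` and for every submodule
`X ⊆ B` with `X ⊓ A = 0` such that `(X ⊕ A)/X` is pure in `B/X`, one has `X = 0`. -/
def IsPureEssential {B : Type u} [AddCommGroup B] [Module R B] (A : Submodule R B) : Prop :=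
  IsPureSubmodule R A ∧
    ∀ X : Submodule R B, X ⊓ A = ⊥ → IsPureMono R (X.mkQ ∘ₗ A.subtype) → X = ⊥

/-- An extension `A ⊆ B` is *strictly pure-essential* if it is pure-essential and for every
extension `B ⊆ Y` in which `A` is pure in `Y`, also `B` is pure in `Y`. -/
def IsStrictlyPureEssential {B : Type u} [AddCommGroup B] [Module R B] (A : Submodule R B) :
    Prop :=
  IsPureEssential R A ∧
    ∀ (Y : Type u) [AddCommGroup Y] [Module R Y] (g : B →ₗ[R] Y),
      Function.Injective g → IsPureMono R (g ∘ₗ A.subtype) → IsPureMono R g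

/-- A module `M` over a local ring is *totally separated* if `X ⊗[R] M` is `𝔪`-adically
separated for every finitely generated `R`-module `X`. -/
def IsTotallySeparatedModule [IsLocalRing R] (M : Type u) [AddCommGroup M] [Module R M] :
    Prop :=
  ∀ (X : Type u) [AddCommGroup X] [Module R X] [Module.Finite R X],
    IsHausdorff (maximalIdeal R) (X ⊗[R] M)

end Definitions

section Helpers

variable {R : Type*} [CommRing R]

/-- Elements of `I • N` are combinations of generators of `I` with coefficients in `N`. -/
lemma exists_sum_smul_of_mem_span_range_smul {M : Type*} [AddCommGroup M] [Module R M]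
    {κ : Type*} [Fintype κ] (f : κ → R) (N : Submodule R M) {x : M}
    (hx : x ∈ Ideal.span (Set.range f) • N) :
    ∃ z : κ → M, (∀ l, z l ∈ N) ∧ x = ∑ l, f l • z l := by
  induction hx using Submodule.smul_induction_on' with
  | smul r hr y hy =>
    obtain ⟨c, rfl⟩ := Ideal.mem_span_range_iff_exists_fun.mp hr
    refine ⟨fun l => c l • y, fun l => N.smul_mem _ hy, ?_⟩
    rw [Finset.sum_smul]
    exact Finset.sum_congr rfl fun l _ => by rw [mul_comm, mul_smul]
  | add x _ y _ hx hy =>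
    obtain ⟨z, hz, rfl⟩ := hx
    obtain ⟨w, hw, rfl⟩ := hy
    exact ⟨z + w, fun l => N.add_mem (hz l) (hw l), by simp [Finset.sum_add_distrib]⟩

lemma map_mem_smul_top {M N : Type*} [AddCommGroup M] [Module R M] [AddCommGroup N] [Module R N]
    (g : M →ₗ[R] N) (I : Ideal R) {x : M} (hx : x ∈ I • (⊤ : Submodule R M)) :
    g x ∈ I • (⊤ : Submodule R N) := by
  have h := Submodule.mem_map_of_mem (f := g) hx
  rw [Submodule.map_smul''] at h
  exact Submodule.smul_mono le_rfl le_top h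

/-- For a finitely generated ideal `I`, the submodule `I • ∏ M i` consists of all families
with components in `I • M i`. -/
lemma mem_smul_top_pi [IsNoetherianRing R] {ι : Type*} {M : ι → Type*}
    [∀ i, AddCommGroup (M i)] [∀ i, Module R (M i)] (I : Ideal R) {v : (i : ι) → M i}
    (hv : ∀ i, v i ∈ I • (⊤ : Submodule R (M i))) :
    v ∈ I • (⊤ : Submodule R ((i : ι) → M i)) := by
  obtain ⟨k, f, rfl⟩ := Submodule.fg_iff_exists_fin_generating_family.mp (IsNoetherian.noetherian I)
  choose z _ hz using fun i => exists_sum_smul_of_mem_span_range_smul f _ (hv i)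
  have h : v = ∑ l, f l • fun i => z i l := by
    ext i
    simpa using hz i
  rw [h]
  exact Submodule.sum_mem _ fun l _ =>
    Submodule.smul_mem_smul (Submodule.subset_span ⟨l, rfl⟩) trivial

/-- Artin-Rees over a flat module, with a constant independent of the module. -/
lemma exists_sum_smul_mem_pow_of_flat {N : Type*} [AddCommGroup N] [Module R N] [IsNoetherianRing R]
    [Module.Flat R N] {I : Ideal R} {k c : ℕ} (f : Fin k → R)
    (hc : ∀ n, I ^ (n + c) ⊓ Ideal.span (Set.range f) ≤ I ^ n * Ideal.span (Set.range f))
    (x : Fin k → N) {n : ℕ} (hv : ∑ l, f l • x l ∈ I ^ (n + c) • (⊤ : Submodule R N)) :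
    ∃ z : Fin k → N, (∀ l, z l ∈ I ^ n • (⊤ : Submodule R N)) ∧
      ∑ l, f l • x l = ∑ l, f l • z l := by
  obtain ⟨m, g, hg⟩ := Submodule.fg_iff_exists_fin_generating_family.mp
    (IsNoetherian.noetherian (I ^ (n + c)))
  rw [← hg] at hv
  obtain ⟨w, -, hw⟩ := exists_sum_smul_of_mem_span_range_smul g _ hv
  have hrel : ∑ s, Sum.elim f g s • Sum.elim x (-w) s = 0 := by
    simp [hw]
  obtain ⟨p, a, y, hy, ha⟩ := Module.Flat.isTrivialRelation_of_sum_smul_eq_zero hrel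
  have hmem (j : Fin p) : ∑ l, f l * a (Sum.inl l) j ∈
      Ideal.span (Set.range f) • I ^ n := by
    rw [smul_eq_mul, mul_comm]
    refine hc n ⟨?_, Ideal.sum_mem _ fun l _ => Ideal.mul_mem_right _ _
      (Ideal.subset_span ⟨l, rfl⟩)⟩
    have h := ha j
    rw [Fintype.sum_sum_type] at h
    simp only [Sum.elim_inl, Sum.elim_inr] at h
    rw [eq_neg_of_add_eq_zero_left h, ← hg]
    exact neg_mem (Ideal.sum_mem _ fun l _ => Ideal.mul_mem_right _ _
      (Ideal.subset_span ⟨l, rfl⟩))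
  choose b hb hbs using fun j => exists_sum_smul_of_mem_span_range_smul f _ (hmem j)
  refine ⟨fun l => ∑ j, b j l • y j, fun l => Submodule.sum_mem _ fun j _ =>
    Submodule.smul_mem_smul (hb j l) trivial, ?_⟩
  have hx (l : Fin k) : x l = ∑ j, a (Sum.inl l) j • y j := hy (Sum.inl l)
  simp_rw [hx, Finset.smul_sum, smul_smul]
  rw [Finset.sum_comm, Finset.sum_comm (s := (Finset.univ : Finset (Fin k)))]
  refine Finset.sum_congr rfl fun j _ => ?_
  rw [← Finset.sum_smul, hbs j, Finset.sum_smul]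
  rfl

lemma exists_sum_smul_mem_pow_of_flat_quotient {M : Type*} [AddCommGroup M] [Module R M]
    [IsNoetherianRing R] (H : Submodule R M) [Module.Flat R (M ⧸ H)] {I : Ideal R} {k c : ℕ}
    (f : Fin k → R)
    (hc : ∀ n, I ^ (n + c) ⊓ Ideal.span (Set.range f) ≤ I ^ n * Ideal.span (Set.range f))
    (x : Fin k → M) {n : ℕ} (hv : ∑ l, f l • x l ∈ I ^ (n + c) • (⊤ : Submodule R M)) :
    ∃ z : Fin k → M, (∀ l, z l ∈ I ^ n • (⊤ : Submodule R M)) ∧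
      ∑ l, f l • (x l - z l) ∈ H := by
  obtain ⟨z, hz, hxz⟩ := exists_sum_smul_mem_pow_of_flat f hc (fun l => H.mkQ (x l))
    (by simpa using map_mem_smul_top H.mkQ _ hv)
  have hlift (l : Fin k) : ∃ w ∈ I ^ n • (⊤ : Submodule R M), H.mkQ w = z l := by
    have h := hz l
    rwa [← H.range_mkQ, ← Submodule.map_top, ← Submodule.map_smul'', Submodule.mem_map] at h
  choose w hw hwz using hlift
  refine ⟨w, hw, ?_⟩
  rw [← Submodule.ker_mkQ H, LinearMap.mem_ker]
  simp only [map_sum, map_smul, map_sub, smul_sub, Finset.sum_sub_distrib, hwz, hxz, sub_self]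

/-- All powers of `I` containing `∑ f l • x l` are controlled by one choice of `z`. -/
lemma exists_sum_smul_mem_forall_pow {M : Type*} [AddCommGroup M] [Module R M]
    [IsNoetherianRing R] {I : Ideal R} {k c : ℕ}
    [Module.Flat R (M ⧸ (⨅ n : ℕ, I ^ n • (⊤ : Submodule R M)))]
    (f : Fin k → R)
    (hc : ∀ n, I ^ (n + c) ⊓ Ideal.span (Set.range f) ≤ I ^ n * Ideal.span (Set.range f))
    (x : Fin k → M) :
    ∃ z : Fin k → M, (∀ n, ∑ l, f l • x l ∈ I ^ (n + c) • (⊤ : Submodule R M) →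
        ∀ l, z l ∈ I ^ n • (⊤ : Submodule R M)) ∧
      ∑ l, f l • (x l - z l) ∈ ⨅ n : ℕ, I ^ n • (⊤ : Submodule R M) := by
  classical
  by_cases hH : ∑ l, f l • x l ∈ ⨅ n : ℕ, I ^ n • (⊤ : Submodule R M)
  · exact ⟨0, fun _ _ _ => zero_mem _, by simpa using hH⟩
  have hex : ∃ n, ∑ l, f l • x l ∉ I ^ (n + c) • (⊤ : Submodule R M) := by
    by_contra! h
    exact hH ((Submodule.mem_iInf _).mpr fun n =>
      Submodule.pow_smul_top_le I M (Nat.le_add_right n c) (h n))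
  have hlt {n : ℕ} (hn : ∑ l, f l • x l ∈ I ^ (n + c) • (⊤ : Submodule R M)) :
      n < Nat.find hex := by
    by_contra! h
    exact Nat.find_spec hex (Submodule.pow_smul_top_le I M (by lia) hn)
  by_cases h0 : Nat.find hex = 0
  · exact ⟨x, fun n hn => absurd (hlt hn) (by lia), by simp⟩
  obtain ⟨z, hz, hxz⟩ := exists_sum_smul_mem_pow_of_flat_quotient
    (⨅ n : ℕ, I ^ n • (⊤ : Submodule R M)) f hc x
    (not_not.mp (Nat.find_min hex (Nat.pred_lt h0)))
  exact ⟨z, fun n hn l => Submodule.pow_smul_top_le I M (Nat.le_pred_of_lt (hlt hn)) (hz l), hxz⟩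

/-- Over a noetherian ring the syzygies of a finite family are finitely generated. -/
lemma exists_syzygies [IsNoetherianRing R] {k : ℕ} (f : Fin k → R) :
    ∃ (p : ℕ) (s : Fin p → Fin k → R), (∀ j, ∑ l, f l * s j l = 0) ∧
      ∀ (a : Fin k → R), ∑ l, f l * a l = 0 → ∃ c : Fin p → R, a = ∑ j, c j • s j := by
  obtain ⟨p, s, hs⟩ := Submodule.fg_iff_exists_fin_generating_family.mp
    (IsNoetherian.noetherian (LinearMap.ker (Fintype.linearCombination R f)))
  have hker (a : Fin k → R) : a ∈ LinearMap.ker (Fintype.linearCombination R f) ↔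
      ∑ l, f l * a l = 0 := by
    simp [Fintype.linearCombination_apply, mul_comm]
  refine ⟨p, s, fun j => (hker _).mp (hs ▸ Submodule.subset_span ⟨j, rfl⟩), fun a ha => ?_⟩
  rw [← hker, ← hs, Submodule.mem_span_range_iff_exists_fun] at ha
  exact ha.imp fun _ h => h.symm

/-- A generating family of syzygies of `f` trivialises every relation with coefficients `f`
modulo a submodule with flat quotient. -/
lemma exists_sub_sum_smul_mem_of_flat_quotient {M : Type*} [AddCommGroup M] [Module R M]
    (H : Submodule R M) [Module.Flat R (M ⧸ H)] {k p : ℕ} (f : Fin k → R)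
    (s : Fin p → Fin k → R)
    (hs : ∀ (a : Fin k → R), ∑ l, f l * a l = 0 → ∃ c : Fin p → R, a = ∑ j, c j • s j)
    (x : Fin k → M) (hx : ∑ l, f l • x l ∈ H) :
    ∃ y : Fin p → M, ∀ l, x l - ∑ j, s j l • y j ∈ H := by
  have hrel : ∑ l, f l • H.mkQ (x l) = 0 := by
    rw [← Submodule.ker_mkQ H, LinearMap.mem_ker] at hx
    simpa only [map_sum, map_smul] using hx
  obtain ⟨q, a, y, hy, ha⟩ := Module.Flat.isTrivialRelation_of_sum_smul_eq_zero hrel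
  choose c hc using fun t => hs (fun l => a l t) (ha t)
  choose w hw using fun t => H.mkQ_surjective (y t)
  refine ⟨fun j => ∑ t, c t j • w t, fun l => ?_⟩
  rw [← Submodule.ker_mkQ H, LinearMap.mem_ker, map_sub, sub_eq_zero]
  refine (hy l).trans ?_
  have hac (t : Fin q) : a l t = ∑ j, c t j * s j l := by
    simpa using congrFun (hc t) l
  simp only [map_sum, map_smul, hw, hac, Finset.sum_smul, Finset.smul_sum, smul_smul]
  rw [Finset.sum_comm]
  simp only [mul_comm]

lemma exists_artinRees_span [IsNoetherianRing R] (I : Ideal R) {k : ℕ} (f : Fin k → R) :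
    ∃ c : ℕ, ∀ n, I ^ (n + c) ⊓ Ideal.span (Set.range f) ≤
      I ^ n * Ideal.span (Set.range f) := by
  obtain ⟨c, hc⟩ := Ideal.exists_pow_inf_eq_pow_smul I (Ideal.span (Set.range f))
  refine ⟨c, fun n => ?_⟩
  have h := hc (n + c) (Nat.le_add_left c n)
  simp only [smul_eq_mul, Ideal.mul_top, Nat.add_sub_cancel] at h
  rw [h]
  exact Ideal.mul_mono_right inf_le_right

variable {ι : Type*} [DecidableEq ι] {M : ι → Type*}
  [∀ i, AddCommGroup (M i)] [∀ i, Module R (M i)]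

lemma mem_iSup_range_single_of_finite {v : (i : ι) → M i} (hv : {i | v i ≠ 0}.Finite) :
    v ∈ ⨆ i, LinearMap.range (LinearMap.single R M i) := by
  have h : v = ∑ i ∈ hv.toFinset, LinearMap.single R M i (v i) := by
    ext j
    simp only [Finset.sum_apply, LinearMap.single_apply]
    by_cases hj : v j = 0 <;> simp [Finset.sum_pi_single, hj]
  rw [h]
  exact Submodule.sum_mem _ fun i _ => Submodule.mem_iSup_of_mem i ⟨_, rfl⟩

lemma finite_of_mem_iSup_range_single {v : (i : ι) → M i}
    (hv : v ∈ ⨆ i, LinearMap.range (LinearMap.single R M i)) : {i | v i ≠ 0}.Finite := by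
  induction hv using Submodule.iSup_induction' with
  | mem i x hx =>
    obtain ⟨y, rfl⟩ := hx
    refine (Set.finite_singleton i).subset fun j hj => ?_
    by_contra hji
    exact hj (by simp [Pi.single_eq_of_ne hji])
  | zero => simp
  | add x y _ _ hx hy =>
    refine (hx.union hy).subset fun j hj => ?_
    by_contra! h
    simp_all

/-- The closure of `⨁ M i` in `∏ M i` for the `I`-adic topology consists of the families
converging to zero. -/
lemma mem_adic_closure_iff_finite [IsNoetherianRing R] (I : Ideal R) {v : (i : ι) → M i} :
    v ∈ ⨅ (n : ℕ) (_ : 1 ≤ n), ((⨆ i, LinearMap.range (LinearMap.single R M i)) ⊔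
      I ^ n • (⊤ : Submodule R ((i : ι) → M i))) ↔
    ∀ n, {i | v i ∉ I ^ n • (⊤ : Submodule R (M i))}.Finite := by
  classical
  simp only [Submodule.mem_iInf]
  constructor
  · intro h n
    rcases Nat.eq_zero_or_pos n with rfl | hn
    · simp
    obtain ⟨d, hd, w, hw, rfl⟩ := Submodule.mem_sup.mp (h n hn)
    refine (finite_of_mem_iSup_range_single hd).subset fun i hi => ?_
    contrapose! hi
    simp only [Set.mem_ofPred_eq, not_not] at hi ⊢
    simpa [hi] using map_mem_smul_top (LinearMap.proj i) _ hw
  · intro h n _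
    refine Submodule.mem_sup.mpr
      ⟨fun i => if v i ∈ I ^ n • (⊤ : Submodule R (M i)) then 0 else v i, ?_,
        fun i => if v i ∈ I ^ n • (⊤ : Submodule R (M i)) then v i else 0, ?_, ?_⟩
    · refine mem_iSup_range_single_of_finite ((h n).subset fun i hi => ?_)
      contrapose! hi
      simp only [Set.mem_ofPred_eq, not_not] at hi ⊢
      simp [hi]
    · refine mem_smul_top_pi _ fun i => ?_
      split_ifs with hi
      exacts [hi, zero_mem _]
    · ext i
      by_cases hi : v i ∈ I ^ n • (⊤ : Submodule R (M i)) <;> simp [hi]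

lemma flat_quotient_component (I : Ideal R) (Md : Submodule R ((i : ι) → M i))
    (hMd : Md = ⨆ i, LinearMap.range (LinearMap.single R M i))
    (hflat : Module.Flat R
      (Md ⧸ (Submodule.comap Md.subtype (⨅ (n : ℕ) (_ : 1 ≤ n), I ^ n • Md)))) (i : ι) :
    Module.Flat R (M i ⧸ (⨅ n : ℕ, I ^ n • (⊤ : Submodule R (M i)))) := by
  have hle : LinearMap.range (LinearMap.single R M i) ≤ Md := by
    rw [hMd]
    exact le_iSup (fun i => LinearMap.range (LinearMap.single R M i)) i
  let g : M i →ₗ[R] Md := (LinearMap.single R M i).codRestrict Md fun x => hle ⟨x, rfl⟩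
  let r : Md →ₗ[R] M i := LinearMap.proj i ∘ₗ Md.subtype
  have hg : (⨅ n : ℕ, I ^ n • (⊤ : Submodule R (M i))) ≤ Submodule.comap g
      (Submodule.comap Md.subtype (⨅ (n : ℕ) (_ : 1 ≤ n), I ^ n • Md)) := by
    intro x hx
    simp only [Submodule.mem_comap, Submodule.mem_iInf] at hx ⊢
    intro n _
    have h := Submodule.mem_map_of_mem (f := LinearMap.single R M i) (hx n)
    rw [Submodule.map_smul'', Submodule.map_top] at h
    exact Submodule.smul_mono le_rfl hle h
  have hr : Submodule.comap Md.subtype (⨅ (n : ℕ) (_ : 1 ≤ n), I ^ n • Md) ≤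
      Submodule.comap r (⨅ n : ℕ, I ^ n • (⊤ : Submodule R (M i))) := by
    intro x hx
    simp only [Submodule.mem_comap, Submodule.mem_iInf] at hx ⊢
    intro n
    rcases Nat.eq_zero_or_pos n with rfl | hn
    · simp
    exact map_mem_smul_top (LinearMap.proj (R := R) (φ := M) i) _
      (Submodule.smul_mono le_rfl le_top (hx n hn))
  refine Module.Flat.of_retract (Submodule.mapQ _ _ g hg) (Submodule.mapQ _ _ r hr) ?_
  ext x
  simp [g, r]

end Helpers

/-- With `M = ⊕ M i ⊆ P = ∏ M i` and `A = ⋂_{n ≥ 1} (M + 𝔪^n P)`: if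
`M/H(M)` is flat, then `P/A` is flat. -/
theorem closure_quotient_flat (R : Type u) [CommRing R] [IsNoetherianRing R] [IsLocalRing R]
    {ι : Type u} [DecidableEq ι] (M : ι → Type u)
    [∀ i, AddCommGroup (M i)] [∀ i, Module R (M i)]
    (Md A : Submodule R ((i : ι) → M i))
    (hMd : Md = ⨆ i, LinearMap.range (LinearMap.single R M i))
    (hA : A = ⨅ (n : ℕ) (_ : 1 ≤ n), (Md ⊔ maximalIdeal R ^ n • ⊤))
    (hflat : Module.Flat R
      (Md ⧸ (Submodule.comap Md.subtype
        (⨅ (n : ℕ) (_ : 1 ≤ n), maximalIdeal R ^ n • Md)))) :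
    Module.Flat R (((i : ι) → M i) ⧸ A) := by
  have hN := flat_quotient_component (maximalIdeal R) Md hMd hflat
  subst hMd hA
  refine Module.Flat.of_forall_isTrivialRelation fun {k f x} hx => ?_
  choose X hX using fun l => Submodule.mkQ_surjective _ (x l)
  obtain ⟨c, hc⟩ := exists_artinRees_span (maximalIdeal R) f
  obtain ⟨p, s, hs, hspan⟩ := exists_syzygies f
  have hv : ∑ l, f l • X l ∈ ⨅ (n : ℕ) (_ : 1 ≤ n),
      ((⨆ i, LinearMap.range (LinearMap.single R M i)) ⊔ maximalIdeal R ^ n • ⊤) := by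
    rw [← Submodule.ker_mkQ (⨅ (n : ℕ) (_ : 1 ≤ n), _), LinearMap.mem_ker]
    simpa only [map_sum, map_smul, hX] using hx
  rw [mem_adic_closure_iff_finite] at hv
  choose z hz hzH using fun i => exists_sum_smul_mem_forall_pow (M := M i) f hc (fun l => X l i)
  choose y hy using fun i => exists_sub_sum_smul_mem_of_flat_quotient _ f s hspan _ (hzH i)
  refine ⟨p, fun l j => s j l, fun j => Submodule.mkQ _ fun i => y i j, fun l => ?_, hs⟩
  rw [← hX l, ← sub_eq_zero]
  simp only [← map_smul, ← map_sum, ← map_sub]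
  rw [← LinearMap.mem_ker, Submodule.ker_mkQ, mem_adic_closure_iff_finite]
  intro n
  refine (hv (n + c)).subset fun i hi => ?_
  contrapose! hi
  simp only [Set.mem_ofPred_eq, not_not] at hi ⊢
  have h := add_mem ((Submodule.mem_iInf _).mp (hy i l) n)
    (hz i n (by simpa using hi) l)
  rw [sub_right_comm, sub_add_cancel] at h
  simpa using h
end

section
/- Let $(M_i)_{i\in I}$ be a family of $R$-modules, $M = \bigoplus_{i\in I} M_i$, $P = \prod_{i\in I} M_i$, $A = \bigcap_{n\ge 1}(M + \mathfrak m^n P)$. Assume $M/H(M)$ is flat and that $M_i$ is not radical (i.e. $\mathfrak m M_i \neq M_i$) for infinitely many $i \in I$. Then $\{\mathfrak p \in \operatorname{Spec}(R) \mid \mathfrak p\cdot(A/M) \neq A/M\} = \operatorname{Spec}(R) \setminus \{\mathfrak m\}$; that is, $\mathfrak m\cdot(A/M) = A/M$, while for every prime ideal $\mathfrak q \subsetneq \mathfrak m$ one has $M + \mathfrak q A \neq A$. -/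
/- Throughout, `(R, 𝔪)` is a commutative noetherian local ring and all modules are `R`-modules.
`AdicCompletion (maximalIdeal R) M` is the `𝔪`-adic completion `lim M/𝔪^n M` and
`IsHausdorff (maximalIdeal R) M` says that `M` is (`𝔪`-adically) separated. -/

open TensorProduct IsLocalRing

universe u

theorem Submodule.exists_sum_of_mem_span_range_smul {R M κ : Type*} [CommRing R]
    [AddCommGroup M] [Module R M] [Fintype κ] (r : κ → R) (N : Submodule R M) {x : M}
    (hx : x ∈ Ideal.span (Set.range r) • N) :
    ∃ y : κ → M, (∀ k, y k ∈ N) ∧ x = ∑ k, r k • y k := by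
  induction hx using Submodule.smul_induction_on' with
  | smul a ha n hn =>
    obtain ⟨c, rfl⟩ := Ideal.mem_span_range_iff_exists_fun.mp ha
    refine ⟨fun k => c k • n, fun k => N.smul_mem _ hn, ?_⟩
    rw [Finset.sum_smul]
    exact Finset.sum_congr rfl fun k _ => by rw [mul_comm, mul_smul]
  | add x hx y hy ihx ihy =>
    obtain ⟨u, hu, rfl⟩ := ihx
    obtain ⟨v, hv, rfl⟩ := ihy
    exact ⟨u + v, fun k => N.add_mem (hu k) (hv k), by simp [Finset.sum_add_distrib]⟩

/-- If `N / H` is flat, then `I N ∩ H ⊆ I H` for every ideal `I`. -/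
theorem Submodule.mem_smul_of_flat_quotient {R N : Type*} [CommRing R] [IsNoetherianRing R]
    [AddCommGroup N] [Module R N] (H : Submodule R N) [Module.Flat R (N ⧸ H)] (I : Ideal R)
    {x : N} (hx : x ∈ H) (hxI : x ∈ I • (⊤ : Submodule R N)) : x ∈ I • H := by
  obtain ⟨m, r, rfl⟩ := Submodule.fg_iff_exists_fin_generating_family.mp
    (IsNoetherian.noetherian I)
  obtain ⟨y, -, rfl⟩ := Submodule.exists_sum_of_mem_span_range_smul r ⊤ hxI
  have h0 : ∑ k, r k • H.mkQ (y k) = 0 := by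
    rw [← (Submodule.Quotient.mk_eq_zero H).mpr hx, ← H.mkQ_apply]
    simp only [map_sum, map_smul]
  obtain ⟨l, a, z, hyz, ha⟩ := Module.Flat.isTrivialRelation_of_sum_smul_eq_zero h0
  choose w hw using fun j => H.mkQ_surjective (z j)
  have hsum : ∑ k, r k • y k = ∑ k, r k • (y k - ∑ j, a k j • w j) := by
    have : ∑ k, r k • ∑ j, a k j • w j = 0 := by
      simp only [Finset.smul_sum, smul_smul]
      rw [Finset.sum_comm]
      exact Finset.sum_eq_zero fun j _ => by rw [← Finset.sum_smul, ha j, zero_smul]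
    simp only [smul_sub, Finset.sum_sub_distrib, this, sub_zero]
  rw [hsum]
  refine Submodule.sum_mem _ fun k _ => Submodule.smul_mem_smul (subset_span ⟨k, rfl⟩) ?_
  rw [← Submodule.Quotient.mk_eq_zero H, ← H.mkQ_apply]
  simp only [map_sub, map_sum, map_smul, hw, hyz, sub_self]

/-- Elements outside a prime `q` act as nonzerodivisors on `F / q F` when `F` is flat. -/
theorem Module.Flat.mem_smul_top_of_smul_mem {R F : Type*} [CommRing R] [IsNoetherianRing R]
    [AddCommGroup F] [Module R F] [Module.Flat R F] (q : Ideal R) [q.IsPrime] {s : R}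
    (hs : s ∉ q) {u : F} (hu : s • u ∈ q • (⊤ : Submodule R F)) :
    u ∈ q • (⊤ : Submodule R F) := by
  obtain ⟨m, r, hr⟩ := Submodule.fg_iff_exists_fin_generating_family.mp
    (IsNoetherian.noetherian q)
  rw [← hr] at hu
  obtain ⟨y, -, hy⟩ := Submodule.exists_sum_of_mem_span_range_smul r ⊤ hu
  let f : Option (Fin m) → R := fun o => o.elim s fun k => -r k
  let x : Option (Fin m) → F := fun o => o.elim u y
  have h0 : ∑ o, f o • x o = 0 := by
    simp [f, x, Fintype.sum_option, hy]
  obtain ⟨l, a, z, hxz, ha⟩ := Module.Flat.isTrivialRelation_of_sum_smul_eq_zero h0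
  have huz : u = ∑ j, a none j • z j := hxz none
  rw [huz]
  refine Submodule.sum_mem _ fun j _ => Submodule.smul_mem_smul ?_ Submodule.mem_top
  have hj : s * a none j = ∑ k, r k * a (some k) j := by
    have := ha j
    simp only [f, Fintype.sum_option, Option.elim, neg_mul, Finset.sum_neg_distrib] at this
    exact eq_of_sub_eq_zero (by rw [sub_eq_add_neg, this])
  have hmem : s * a none j ∈ q := by
    rw [hj]
    exact Ideal.sum_mem _ fun k _ =>
      Ideal.mul_mem_right _ _ (hr ▸ Submodule.subset_span ⟨k, rfl⟩)
  exact (Ideal.IsPrime.mem_or_mem ‹_› hmem).resolve_left hs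

section Pi

variable {R ι : Type*} [CommRing R] {M : ι → Type*}
  [∀ i, AddCommGroup (M i)] [∀ i, Module R (M i)]

theorem Submodule.apply_mem_smul_top {I : Ideal R} {x : (i : ι) → M i}
    (hx : x ∈ I • (⊤ : Submodule R ((i : ι) → M i))) (i : ι) :
    x i ∈ I • (⊤ : Submodule R (M i)) := by
  have := Submodule.mem_map_of_mem (f := LinearMap.proj i) hx
  rw [Submodule.map_smul''] at this
  exact Submodule.smul_mono le_rfl le_top this

theorem Submodule.mem_smul_top_pi {I : Ideal R} (hI : I.FG) {x : (i : ι) → M i}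
    (hx : ∀ i, x i ∈ I • (⊤ : Submodule R (M i))) :
    x ∈ I • (⊤ : Submodule R ((i : ι) → M i)) := by
  obtain ⟨m, r, rfl⟩ := Submodule.fg_iff_exists_fin_generating_family.mp hI
  choose y _ hy using fun i => Submodule.exists_sum_of_mem_span_range_smul r ⊤ (hx i)
  have : x = ∑ k, r k • fun i => y i k := by
    ext i
    simp [hy i]
  rw [this]
  exact Submodule.sum_mem _ fun k _ =>
    Submodule.smul_mem_smul (subset_span ⟨k, rfl⟩) Submodule.mem_top

variable [DecidableEq ι]

theorem Submodule.single_mem_iSup_range_single (i : ι) (v : M i) :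
    LinearMap.single R M i v ∈ ⨆ i, LinearMap.range (LinearMap.single R M i) :=
  Submodule.mem_iSup_of_mem i ⟨v, rfl⟩

theorem Submodule.mem_iSup_range_single_iff {x : (i : ι) → M i} :
    x ∈ ⨆ i, LinearMap.range (LinearMap.single R M i) ↔ {i | x i ≠ 0}.Finite := by
  constructor
  · intro hx
    induction hx using Submodule.iSup_induction' with
    | mem i x hx =>
      obtain ⟨v, rfl⟩ := hx
      refine (Set.finite_singleton i).subset fun j hj => ?_
      by_contra hji
      exact hj (by simpa using Pi.single_eq_of_ne hji v)
    | zero => simp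
    | add x y _ _ hx hy =>
      refine (hx.union hy).subset fun i hi => ?_
      by_contra! h
      simp_all
  · intro hx
    have : x = ∑ i ∈ hx.toFinset, LinearMap.single R M i (x i) := by
      ext j
      rw [Finset.sum_apply]
      by_cases hj : x j = 0
      · rw [hj, Finset.sum_eq_zero]
        intro i _
        by_cases hij : j = i
        · subst hij; simp [hj]
        · simpa using Pi.single_eq_of_ne hij (x i)
      · rw [Finset.sum_eq_single j]
        · simp
        · intro i _ hij
          simpa using Pi.single_eq_of_ne hij.symm (x i)
        · simp [hj]
    rw [this]
    exact Submodule.sum_mem _ fun i _ => Submodule.single_mem_iSup_range_single i _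

theorem Submodule.finite_of_mem_iSup_range_single_sup {I : Ideal R} {x : (i : ι) → M i}
    (hx : x ∈ (⨆ i, LinearMap.range (LinearMap.single R M i)) ⊔ I • ⊤) :
    {i | x i ∉ I • (⊤ : Submodule R (M i))}.Finite := by
  obtain ⟨d, hd, z, hz, rfl⟩ := Submodule.mem_sup.mp hx
  refine (Submodule.mem_iSup_range_single_iff.mp hd).subset fun i hi => ?_
  rintro (h0 : d i = 0)
  exact hi (by simpa [h0] using Submodule.apply_mem_smul_top hz i)

theorem Submodule.mem_iSup_range_single_sup_iff {I : Ideal R} (hI : I.FG) {x : (i : ι) → M i} :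
    x ∈ (⨆ i, LinearMap.range (LinearMap.single R M i)) ⊔ I • ⊤ ↔
      {i | x i ∉ I • (⊤ : Submodule R (M i))}.Finite := by
  classical
  refine ⟨Submodule.finite_of_mem_iSup_range_single_sup, fun h => ?_⟩
  let d : (i : ι) → M i := fun i => if x i ∈ I • (⊤ : Submodule R (M i)) then 0 else x i
  rw [← add_sub_cancel d x]
  refine Submodule.add_mem_sup (Submodule.mem_iSup_range_single_iff.mpr ?_)
    (Submodule.mem_smul_top_pi hI fun i => ?_)
  · refine h.subset fun i hi hxi => hi ?_
    simp only [d, if_pos hxi]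
  · by_cases hxi : x i ∈ I • (⊤ : Submodule R (M i)) <;> simp [d, hxi]

end Pi

/-- If `⋂ n, I ^ n N` is contained in `I ⋂ n, I ^ n N`, then every element of `I N` can be
divided by generators of `I` at the cost of lowering its `I`-adic order by at most one. -/
theorem Submodule.exists_sum_smul_of_mem_span_range_smul_top {R N κ : Type*} [CommRing R]
    [AddCommGroup N] [Module R N] [Fintype κ] (r : κ → R) {I : Ideal R}
    (hI : Ideal.span (Set.range r) = I)
    (hH : ∀ v : N, (∀ n, v ∈ I ^ n • (⊤ : Submodule R N)) →
      v ∈ I • ⨅ n, I ^ n • (⊤ : Submodule R N))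
    {x : N} (hx : x ∈ I • (⊤ : Submodule R N)) :
    ∃ y : κ → N, x = ∑ k, r k • y k ∧
      ∀ n, x ∈ I ^ (n + 1) • (⊤ : Submodule R N) →
        ∀ k, y k ∈ I ^ n • (⊤ : Submodule R N) := by
  classical
  by_cases hall : ∀ n, x ∈ I ^ n • (⊤ : Submodule R N)
  · have hxH := hH x hall
    nth_rw 1 [← hI] at hxH
    obtain ⟨y, hy, hxy⟩ := Submodule.exists_sum_of_mem_span_range_smul r _ hxH
    exact ⟨y, hxy, fun n _ k => (Submodule.mem_iInf _).mp (hy k) n⟩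
  · push Not at hall
    obtain ⟨p, hp, hmin⟩ : ∃ p, x ∉ I ^ (p + 2) • (⊤ : Submodule R N) ∧
        x ∈ I ^ (p + 1) • (⊤ : Submodule R N) := by
      have hspec := Nat.find_spec hall
      have hlt : ∀ n < Nat.find hall, x ∈ I ^ n • (⊤ : Submodule R N) := fun n hn => by
        simpa using Nat.find_min hall hn
      generalize Nat.find hall = m at hspec hlt
      match m with
      | 0 => simp at hspec
      | 1 => simp [hx] at hspec
      | p + 2 => exact ⟨p, hspec, hlt _ (by lia)⟩
    have hxp : x ∈ Ideal.span (Set.range r) • (I ^ p • (⊤ : Submodule R N)) := by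
      rwa [hI, ← Submodule.mul_smul, ← pow_succ']
    obtain ⟨y, hy, hxy⟩ := Submodule.exists_sum_of_mem_span_range_smul r _ hxp
    refine ⟨y, hxy, fun n hn k => ?_⟩
    have hnp : n ≤ p := by
      by_contra! hlt
      exact hp (Submodule.smul_mono_left (Ideal.pow_le_pow_right (by lia)) hn)
    exact Submodule.smul_mono_left (Ideal.pow_le_pow_right hnp) (hy k)

/-- With `M = ⊕ M i ⊆ P = ∏ M i` and `A = ⋂_{n ≥ 1} (M + 𝔪^n P)`: if
`M/H(M)` is flat and infinitely many `M i` are not radical, then `𝔪 (A/M) = A/M` while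
`M + 𝔮 A ≠ A` for every prime ideal `𝔮 ⊊ 𝔪`. -/
theorem coass_closure_quotient (R : Type u) [CommRing R] [IsNoetherianRing R] [IsLocalRing R]
    {ι : Type u} [DecidableEq ι] (M : ι → Type u)
    [∀ i, AddCommGroup (M i)] [∀ i, Module R (M i)]
    (Md A : Submodule R ((i : ι) → M i))
    (hMd : Md = ⨆ i, LinearMap.range (LinearMap.single R M i))
    (hA : A = ⨅ (n : ℕ) (_ : 1 ≤ n), (Md ⊔ maximalIdeal R ^ n • ⊤))
    (hflat : Module.Flat R
      (Md ⧸ (Submodule.comap Md.subtype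
        (⨅ (n : ℕ) (_ : 1 ≤ n), maximalIdeal R ^ n • Md))))
    (hnotrad : {i : ι |
      ¬ maximalIdeal R • (⊤ : Submodule R (M i)) = ⊤}.Infinite) :
    Md ⊔ maximalIdeal R • A = A ∧
      ∀ q : Ideal R, q.IsPrime → q < maximalIdeal R → Md ⊔ q • A ≠ A := by
  set m := maximalIdeal R
  set H : Submodule R Md := Submodule.comap Md.subtype (⨅ (n : ℕ) (_ : 1 ≤ n), m ^ n • Md)
  let sg : ∀ i, M i →ₗ[R] Md := fun i => (LinearMap.single R M i).codRestrict Md fun v => by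
    rw [hMd]; exact Submodule.single_mem_iSup_range_single i v
  let pr : ∀ i, Md →ₗ[R] M i := fun i => LinearMap.proj i ∘ₗ Md.subtype
  have hprsg : ∀ i v, pr i (sg i v) = v := fun i v => by simp [pr, sg]
  have hpr : ∀ i (I : Ideal R) (N : Submodule R Md) {x : Md}, x ∈ I • N →
      pr i x ∈ I • N.map (pr i) := fun i I N x hx => by
    rw [← Submodule.map_smul'']; exact Submodule.mem_map_of_mem hx
  have hsg : ∀ i (I : Ideal R) {v : M i}, v ∈ I • (⊤ : Submodule R (M i)) →
      sg i v ∈ I • (⊤ : Submodule R Md) := fun i I v hv => by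
    have := Submodule.mem_map_of_mem (f := sg i) hv
    rw [Submodule.map_smul''] at this
    exact Submodule.smul_mono le_rfl le_top this
  have hmemH : ∀ x : Md, x ∈ H ↔ ∀ n, x ∈ m ^ n • (⊤ : Submodule R Md) := fun x => by
    have key : ∀ n, (x : (i : ι) → M i) ∈ m ^ n • Md ↔ x ∈ m ^ n • (⊤ : Submodule R Md) :=
      fun n => by
        have : m ^ n • Md = (m ^ n • (⊤ : Submodule R Md)).map Md.subtype := by
          rw [Submodule.map_smul'', Submodule.map_top, Submodule.range_subtype]
        rw [this]
        exact ⟨fun ⟨y, hy, hyx⟩ => Subtype.ext hyx ▸ hy, fun h => ⟨x, h, rfl⟩⟩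
    simp only [H, Submodule.mem_comap, Submodule.mem_iInf, Submodule.subtype_apply, key]
    refine ⟨fun h n => ?_, fun h n _ => h n⟩
    rcases n with _ | n
    · simp
    · exact h _ (by lia)
  have hprH : ∀ i, H.map (pr i) ≤ ⨅ n, m ^ n • (⊤ : Submodule R (M i)) := by
    rintro i _ ⟨x, hx, rfl⟩
    exact (Submodule.mem_iInf _).mpr fun n =>
      Submodule.smul_mono le_rfl le_top (hpr i _ _ ((hmemH x).mp hx n))
  have hmemA : ∀ x, x ∈ A ↔ ∀ n, {i | x i ∉ m ^ n • (⊤ : Submodule R (M i))}.Finite :=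
    fun x => by
      simp only [hA, hMd, Submodule.mem_iInf,
        Submodule.mem_iSup_range_single_sup_iff (IsNoetherian.noetherian (m ^ _))]
      refine ⟨fun h n => ?_, fun h n _ => h n⟩
      rcases n with _ | n
      · simp
      · exact h _ (by lia)
  have hMdA : Md ≤ A := by
    rw [hA]
    exact le_iInf₂ fun n _ => le_sup_left
  refine ⟨le_antisymm (sup_le hMdA Submodule.smul_le_right) fun x hx => ?_, ?_⟩
  · obtain ⟨l, r, hr⟩ := Submodule.fg_iff_exists_fin_generating_family.mp
      (IsNoetherian.noetherian m)
    have hH : ∀ i (v : M i), (∀ n, v ∈ m ^ n • (⊤ : Submodule R (M i))) →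
        v ∈ m • ⨅ n, m ^ n • (⊤ : Submodule R (M i)) := fun i v hv => by
      have h1 : sg i v ∈ m • H := Submodule.mem_smul_of_flat_quotient H m
        ((hmemH _).mpr fun n => hsg i _ (hv n)) (hsg i m (by simpa using hv 1))
      have h2 := hpr i m H h1
      rw [hprsg] at h2
      exact Submodule.smul_mono le_rfl (hprH i) h2
    have hex : ∀ i, ∃ y : Fin l → M i,
        (x i ∈ m • (⊤ : Submodule R (M i)) → x i = ∑ k, r k • y k) ∧
        ∀ n, x i ∈ m ^ (n + 1) • (⊤ : Submodule R (M i)) →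
          ∀ k, y k ∈ m ^ n • (⊤ : Submodule R (M i)) := fun i => by
      by_cases hxi : x i ∈ m • (⊤ : Submodule R (M i))
      · obtain ⟨y, h1, h2⟩ :=
          Submodule.exists_sum_smul_of_mem_span_range_smul_top r hr (hH i) hxi
        exact ⟨y, fun _ => h1, h2⟩
      · exact ⟨0, fun h => absurd h hxi, fun n _ k => zero_mem _⟩
    choose y hy1 hy2 using hex
    rw [← sub_add_cancel x (∑ k, r k • fun i => y i k)]
    refine Submodule.add_mem_sup ?_ (Submodule.sum_mem _ fun k _ =>
      Submodule.smul_mem_smul (hr ▸ Submodule.subset_span ⟨k, rfl⟩) ((hmemA _).mpr fun n => ?_))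
    · rw [hMd, Submodule.mem_iSup_range_single_iff]
      refine ((hmemA x).mp hx 1).subset fun i hi hxi => hi ?_
      rw [pow_one] at hxi
      simp [← hy1 i hxi]
    · exact ((hmemA x).mp hx (n + 1)).subset fun i hi hxi => hi (hy2 i n hxi k)
  · intro q hq hqm heq
    obtain ⟨s, hsm, hsq⟩ := SetLike.exists_of_lt hqm
    have hdiv : ∀ i (u : M i) n, s ^ n • u ∈ q • (⊤ : Submodule R (M i)) →
        u ∈ m • (⊤ : Submodule R (M i)) := fun i u n hu => by
      have hmap : (q • (⊤ : Submodule R Md)).map H.mkQ = q • ⊤ := by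
        rw [Submodule.map_smul'', Submodule.map_top, Submodule.range_mkQ]
      have h1 : s ^ n • H.mkQ (sg i u) ∈ q • (⊤ : Submodule R (Md ⧸ H)) := by
        rw [← map_smul, ← map_smul, ← hmap]
        exact Submodule.mem_map_of_mem (hsg i q hu)
      have h2 := Module.Flat.mem_smul_top_of_smul_mem q
        (fun h => hsq (hq.mem_of_pow_mem n h)) h1
      rw [← hmap] at h2
      obtain ⟨w, hw, hwu⟩ := h2
      have h3 : w - sg i u ∈ H := (Submodule.Quotient.eq H).mp hwu
      have h4 : pr i (w - sg i u) ∈ m • (⊤ : Submodule R (M i)) := by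
        simpa using (Submodule.mem_iInf _).mp (hprH i (Submodule.mem_map_of_mem h3)) 1
      have h5 : pr i w ∈ m • (⊤ : Submodule R (M i)) :=
        Submodule.smul_mono hqm.le le_top (hpr i q ⊤ hw)
      rw [map_sub, hprsg] at h4
      simpa using sub_mem h5 h4
    have hex : ∀ i, ∃ u : M i, ¬ m • (⊤ : Submodule R (M i)) = ⊤ →
        u ∉ m • (⊤ : Submodule R (M i)) := fun i => by
      by_cases h : m • (⊤ : Submodule R (M i)) = ⊤
      · exact ⟨0, fun h' => absurd h h'⟩
      · by_contra! hall
        exact h (eq_top_iff.mpr fun u _ => (hall u).2)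
    choose u hu using hex
    let e := hnotrad.natEmbedding
    let g : ℕ → ι := fun j => e j
    have hg : Function.Injective g := Subtype.val_injective.comp e.injective
    classical
    let x : (i : ι) → M i := fun i =>
      if i ∈ Set.range g then s ^ Function.invFun g i • u i else 0
    have hxg : ∀ j, x (g j) = s ^ j • u (g j) := fun j => by
      simp only [x, if_pos (Set.mem_range_self j), Function.leftInverse_invFun hg j]
    have hxA : x ∈ A := (hmemA x).mpr fun n => by
      refine ((Set.finite_Iio n).image g).subset fun i hi => ?_
      by_cases hig : i ∈ Set.range g
      · obtain ⟨j, rfl⟩ := hig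
        refine ⟨j, ?_, rfl⟩
        by_contra hj
        rw [Set.mem_Iio, not_lt] at hj
        refine hi ?_
        rw [hxg]
        exact Submodule.smul_mem_smul (Ideal.pow_le_pow_right hj (Ideal.pow_mem_pow hsm j))
          Submodule.mem_top
      · exact absurd (by simp only [x, if_neg hig, zero_mem]) hi
    have hxq : x ∈ (⨆ i, LinearMap.range (LinearMap.single R M i)) ⊔ q • ⊤ := by
      rw [← hMd]
      exact sup_le_sup_left (Submodule.smul_mono le_rfl le_top) Md (heq ▸ hxA)
    refine Set.infinite_range_of_injective hg
      ((Submodule.finite_of_mem_iSup_range_single_sup hxq).subset ?_)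
    rintro _ ⟨j, rfl⟩ hj
    rw [hxg] at hj
    exact hu (g j) (e j).2 (hdiv _ _ _ hj)
end
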